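/- No order-based semantics is ·-composable: for every suitable order ⪯ there exist a database D and regular expressions R, R′ such that S_⪯(D,R) · S_⪯(D,R′) is not a subset of S_⪯(D, R·R′). -/

import Mathlib

namespace RPQ

/-- Vertex identifiers. -/
abbrev V : Type := ℕ
/-- Edge identifiers. -/
abbrev Edg : Type := ℕ
/-- Labels. -/
abbrev Lab : Type := ℕ

/-- A walk: a nonempty alternating sequence `v₀,e₁,v₁,…,e_k,v_k`, encoded as the
initial vertex together with the list of (edge, next-vertex) pairs. -/
structure Walk where
  head : V
  steps : List (Edg × V)
deriving DecidableEq

namespace Walk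

def length (w : Walk) : ℕ := w.steps.length
def src (w : Walk) : V := w.head
def tgt (w : Walk) : V := (w.steps.map Prod.snd).getLastD w.head
/-- The pair of endpoints of a walk. -/
def ep (w : Walk) : V × V := (w.src, w.tgt)
def vertexList (w : Walk) : List V := w.head :: w.steps.map Prod.snd
def edgeList (w : Walk) : List Edg := w.steps.map Prod.fst
/-- Concatenation of walks (meaningful when `w.tgt = w'.src`). -/
def concat (w w' : Walk) : Walk := ⟨w.head, w.steps ++ w'.steps⟩

end Walk

/-- A graph database. -/
structure Database where
  labels : Finset Lab
  verts : Finset V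
  edges : Finset Edg
  src : Edg → V
  tgt : Edg → V
  lbl : Edg → Lab
  src_mem : ∀ e ∈ edges, src e ∈ verts
  tgt_mem : ∀ e ∈ edges, tgt e ∈ verts
  lbl_mem : ∀ e ∈ edges, lbl e ∈ labels

def chainFrom (D : Database) : V → List (Edg × V) → Prop
  | _, [] => True
  | v, (e, v') :: rest =>
      e ∈ D.edges ∧ D.src e = v ∧ D.tgt e = v' ∧ chainFrom D v' rest

/-- `w` is consistent with `D`, i.e. `w` is a walk in `D`. -/
def Walk.Consistent (D : Database) (w : Walk) : Prop :=
  w.head ∈ D.verts ∧ chainFrom D w.head w.steps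

/-- The set of walks in `D`. -/
def Walks (D : Database) : Set Walk := {w | w.Consistent D}

/-- The label of a walk in `D`: the word of its successive edge labels. -/
def Walk.label (D : Database) (w : Walk) : List Lab :=
  w.steps.map fun p => D.lbl p.1

abbrev RE := RegularExpression Lab

/-- Matches of `R` in `D`: walks in `D` whose label conforms to `R`. -/
def Matches (D : Database) (R : RE) : Set Walk :=
  {w | w.Consistent D ∧ w.label D ∈ R.matches'}

/-- A semantics maps a database and a query to a finite subset of its matches. -/
def IsSemantics (S : Database → RE → Set Walk) : Prop :=
  ∀ D R, S D R ⊆ Matches D R ∧ (S D R).Finite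

/-- `S` is walk-based. -/
def WalkBased (S : Database → RE → Set Walk) : Prop :=
  ∃ r : Set Walk → Set Walk, ∀ D R, S D R = r (Matches D R)

/-- The semantics defined by a filter `f`. -/
def FilterSem (f : Walk → Bool) (D : Database) (R : RE) : Set Walk :=
  {w ∈ Matches D R | f w = true}

/-- Componentwise inclusion of databases. -/
def Database.Sub (D D' : Database) : Prop :=
  D.labels ⊆ D'.labels ∧ D.verts ⊆ D'.verts ∧ D.edges ⊆ D'.edges ∧
    ∀ e ∈ D.edges, D'.src e = D.src e ∧ D'.tgt e = D.tgt e ∧ D'.lbl e = D.lbl e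

def IsPartialOrderRel (le : Walk → Walk → Prop) : Prop :=
  (∀ w, le w w) ∧ (∀ a b c, le a b → le b c → le a c) ∧ ∀ a b, le a b → le b a → a = b

/-- `le` is a well-partial-order on the walks of `D`. -/
def IsWpoOn (le : Walk → Walk → Prop) (D : Database) : Prop :=
  ∀ f : ℕ → Walk, (∀ n, (f n).Consistent D) → ∃ i j, i < j ∧ le (f i) (f j)

/-- Suitable order: a partial order on walks that is a wpo on `Walks D` for each `D`. -/
def Suitable (le : Walk → Walk → Prop) : Prop :=
  IsPartialOrderRel le ∧ ∀ D, IsWpoOn le D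

/-- The semantics based on the order `le`: the `le`-minimal matches among those
with the same endpoints. -/
def OrderSem (le : Walk → Walk → Prop) (D : Database) (R : RE) : Set Walk :=
  {w ∈ Matches D R | ∀ w' ∈ Matches D R, w'.ep = w.ep → le w' w → w' = w}

def Monotonous (S : Database → RE → Set Walk) : Prop :=
  ∀ D D' R, D.Sub D' → S D R ⊆ S D' R

def CoMonotonous (S : Database → RE → Set Walk) : Prop :=
  ∀ D D' R, D.Sub D' → S D' R ∩ Walks D ⊆ S D R

def Stabilizing (S : Database → RE → Set Walk) : Prop :=
  ∀ (D : Database) (Rs : ℕ → RE),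
    (∀ i j, i ≤ j → ∀ u, u ∈ (Rs i).matches' → u ∈ (Rs j).matches') →
    ∃ N, ∀ n, N ≤ n → S D (Rs n) = S D (Rs N)

/-- Concatenation lifted to sets of walks. -/
def setConcat (W W' : Set Walk) : Set Walk :=
  {u | ∃ w ∈ W, ∃ w' ∈ W', w.tgt = w'.src ∧ u = w.concat w'}

/-- `setStar W` : all concatenations `w₁·…·w_k` (k ≥ 1) of walks of `W`. -/
inductive setStar (W : Set Walk) : Walk → Prop
  | base : ∀ w ∈ W, setStar W w
  | step : ∀ u w, setStar W u → w ∈ W → u.tgt = w.src → setStar W (u.concat w)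

/-- Walks jointly consistent with some database. -/
def ConsistentPair (w w' : Walk) : Prop :=
  ∃ D : Database, w.Consistent D ∧ w'.Consistent D

/-- The trimming of an order. -/
def trimRel (le : Walk → Walk → Prop) (w w' : Walk) : Prop :=
  ConsistentPair w w' ∧ w.ep = w'.ep ∧ le w w'

def Trimmed (le : Walk → Walk → Prop) : Prop := trimRel le = le

/-- `le` respects element inclusion. -/
def RespectsElemIncl (le : Walk → Walk → Prop) : Prop :=
  ∀ w w', le w w' →
    (∀ v ∈ w.vertexList, v ∈ w'.vertexList) ∧ ∀ e ∈ w.edgeList, e ∈ w'.edgeList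

/-- Action of a relabeling on a database. -/
def Database.relabel (π : Equiv.Perm Lab) (D : Database) : Database where
  labels := D.labels.image (⇑π)
  verts := D.verts
  edges := D.edges
  src := D.src
  tgt := D.tgt
  lbl := fun e => π (D.lbl e)
  src_mem := D.src_mem
  tgt_mem := D.tgt_mem
  lbl_mem := fun e he => Finset.mem_image_of_mem (⇑π) (D.lbl_mem e he)

/-- Action of a renaming on a walk. -/
def Walk.rename (νv : Equiv.Perm V) (νe : Equiv.Perm Edg) (w : Walk) : Walk :=
  ⟨νv w.head, w.steps.map fun p => (νe p.1, νv p.2)⟩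

/-- Action of a renaming on a database. -/
def Database.rename (νv : Equiv.Perm V) (νe : Equiv.Perm Edg) (D : Database) :
    Database where
  labels := D.labels
  verts := D.verts.image (⇑νv)
  edges := D.edges.image (⇑νe)
  src := fun e => νv (D.src (νe.symm e))
  tgt := fun e => νv (D.tgt (νe.symm e))
  lbl := fun e => D.lbl (νe.symm e)
  src_mem := by
    intro e he
    obtain ⟨e', he', rfl⟩ := Finset.mem_image.mp he
    simpa using Finset.mem_image_of_mem (⇑νv) (D.src_mem e' he')
  tgt_mem := by
    intro e he
    obtain ⟨e', he', rfl⟩ := Finset.mem_image.mp he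
    simpa using Finset.mem_image_of_mem (⇑νv) (D.tgt_mem e' he')
  lbl_mem := by
    intro e he
    obtain ⟨e', he', rfl⟩ := Finset.mem_image.mp he
    simpa using D.lbl_mem e' he'

/-- Identifier independence. -/
def IdIndependent (S : Database → RE → Set Walk) : Prop :=
  ∀ (νv : Equiv.Perm V) (νe : Equiv.Perm Edg) (D : Database) (R : RE),
    Walk.rename νv νe '' S D R = S (Database.rename νv νe D) R

/-- Unbounded semantics. -/
def Unbounded (S : Database → RE → Set Walk) : Prop :=
  ∀ n : ℕ, ∃ (D : Database) (R : RE) (w : Walk), w ∈ S D R ∧ n ≤ w.length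

/-- Shortest-walk semantics. -/
def Sh (D : Database) (R : RE) : Set Walk :=
  {w ∈ Matches D R | ∀ w' ∈ Matches D R, w'.ep = w.ep → w.length ≤ w'.length}

/-- The factor-inserting relation `F`. -/
def FactorIns (w w' : Walk) : Prop :=
  ∃ w₁ w₂ w₃ : Walk, w₁.tgt = w₂.src ∧ w₂.tgt = w₃.src ∧ w₁.tgt = w₃.src ∧
    w = w₁.concat w₃ ∧ w' = (w₁.concat w₂).concat w₃

/-- The subwalk order: reflexive–transitive closure of `FactorIns`. -/
def SubwalkOrd : Walk → Walk → Prop := Relation.ReflTransGen FactorIns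

/-- The database with two vertices `0`, `1` and one edge in each direction between them, all
edges carrying the label `0`. -/
def cycleDB : Database where
  labels := {0}
  verts := {0, 1}
  edges := {0, 1}
  src := fun e => e
  tgt := fun e => 1 - e
  lbl := fun _ => 0
  src_mem := fun _ h => h
  tgt_mem := by decide
  lbl_mem := by decide

/-- The steps of the walk of length `n` in `cycleDB` starting at `v`. -/
def cycleSteps : V → ℕ → List (Edg × V)
  | _, 0 => []
  | v, n + 1 => (v, 1 - v) :: cycleSteps (1 - v) n

@[simp] theorem length_cycleSteps (v : V) (n : ℕ) : (cycleSteps v n).length = n := by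
  induction n generalizing v with
  | zero => rfl
  | succ n ih => simp [cycleSteps, ih]

theorem mem_cycleDB_verts {v : ℕ} : v ∈ cycleDB.verts ↔ v ≤ 1 := by
  simp only [cycleDB, Finset.mem_insert, Finset.mem_singleton]
  exact Nat.le_one_iff_eq_zero_or_eq_one.symm

theorem chainFrom_cycleSteps {v : V} (hv : v ≤ 1) (n : ℕ) :
    chainFrom cycleDB v (cycleSteps v n) := by
  induction n generalizing v with
  | zero => trivial
  | succ n ih => exact ⟨mem_cycleDB_verts.2 hv, rfl, rfl, ih (Nat.sub_le 1 v)⟩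

theorem eq_cycleSteps {v : V} {l : List (Edg × V)} (h : chainFrom cycleDB v l) :
    l = cycleSteps v l.length := by
  induction l generalizing v with
  | nil => rfl
  | cons p l ih =>
    obtain ⟨e, v'⟩ := p
    obtain ⟨-, rfl, rfl, h⟩ := h
    exact congrArg _ (ih h)

theorem cycleSteps_append {v : V} (hv : v ≤ 1) (m n : ℕ) (hm : Even m) :
    cycleSteps v m ++ cycleSteps v n = cycleSteps v (m + n) := by
  obtain ⟨k, rfl⟩ := hm
  induction k with
  | zero => simp [cycleSteps]
  | succ k ih =>
    rw [show k + 1 + (k + 1) = k + k + 1 + 1 by ring,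
      show k + k + 1 + 1 + n = k + k + n + 1 + 1 by ring]
    simp only [cycleSteps, Nat.sub_sub_self hv, List.cons_append, ih]

/-- The walk of length `n` in `cycleDB` starting at the vertex `0`. -/
def cycleWalk (n : ℕ) : Walk := ⟨0, cycleSteps 0 n⟩

theorem consistent_cycleWalk (n : ℕ) : (cycleWalk n).Consistent cycleDB :=
  ⟨mem_cycleDB_verts.2 zero_le_one, chainFrom_cycleSteps zero_le_one n⟩

theorem getLastD_of_chainFrom {v : ℕ} {l : List (Edg × V)} (h : chainFrom cycleDB v l)
    (hv : v ≤ 1) : (l.map Prod.snd).getLastD v = (v + l.length) % 2 := by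
  induction l generalizing v with
  | nil => exact (Nat.mod_eq_of_lt (Nat.lt_succ_of_le hv)).symm
  | cons p l ih =>
    obtain ⟨e, v'⟩ := p
    obtain ⟨-, rfl, rfl, h⟩ := h
    rw [List.map_cons, List.getLastD_cons, ih h (Nat.sub_le 1 _), List.length_cons]
    have parity (k : ℕ) (hk : k ≤ 1) :
        (1 - k + l.length) % 2 = (k + (l.length + 1)) % 2 := by omega
    exact parity e hv

theorem tgt_of_consistent {w : Walk} (h : w.Consistent cycleDB) :
    w.tgt = (w.head + w.length) % 2 :=
  getLastD_of_chainFrom h.2 (mem_cycleDB_verts.1 h.1)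

theorem label_cycleDB (w : Walk) : w.label cycleDB = List.replicate w.length 0 := by
  simp [Walk.label, Walk.length, cycleDB, List.map_const']

theorem mem_singleton_pow {α : Type*} (a : α) (n : ℕ) (u : List α) :
    u ∈ ({[a]} : Language α) ^ n ↔ u = List.replicate n a := by
  induction n generalizing u with
  | zero => simp [Language.mem_one]
  | succ n ih =>
    rw [pow_succ', Language.mem_mul]
    constructor
    · rintro ⟨x, rfl, y, hy, rfl⟩
      simp [(ih y).1 hy, List.replicate_succ]
    · rintro rfl
      exact ⟨[a], rfl, _, (ih _).2 rfl, rfl⟩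

/-- The expression matching the words of length `m` or `n` over the single letter `0`. -/
def lengthRE (m n : ℕ) : RE := RegularExpression.char 0 ^ m + RegularExpression.char 0 ^ n

theorem replicate_mem_lengthRE {k m n : ℕ} :
    List.replicate k 0 ∈ (lengthRE m n).matches' ↔ k = m ∨ k = n := by
  simp [lengthRE, RegularExpression.matches'_pow, Language.mem_add, mem_singleton_pow]

theorem mem_matches_lengthRE {w : Walk} {m n : ℕ} :
    w ∈ Matches cycleDB (lengthRE m n) ↔
      w.Consistent cycleDB ∧ (w.length = m ∨ w.length = n) := by
  simp only [Matches, Set.mem_ofPred_eq, label_cycleDB, replicate_mem_lengthRE]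

theorem length_cycleWalk (n : ℕ) : (cycleWalk n).length = n := length_cycleSteps 0 n

theorem ep_cycleWalk (n : ℕ) : (cycleWalk n).ep = (0, n % 2) := by
  rw [Walk.ep, tgt_of_consistent (consistent_cycleWalk n), length_cycleWalk]
  simp [Walk.src, cycleWalk]

/-- Matches of lengths of different parities never compete for the same endpoints. -/
theorem cycleWalk_mem_orderSem (le : Walk → Walk → Prop) {m n : ℕ} (hm : Odd m) (hn : Even n) :
    cycleWalk n ∈ OrderSem le cycleDB (lengthRE m n) := by
  refine ⟨mem_matches_lengthRE.2 ⟨consistent_cycleWalk n, .inr (length_cycleWalk n)⟩, ?_⟩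
  intro w hw hep _
  obtain ⟨hc, hl⟩ := mem_matches_lengthRE.1 hw
  rw [ep_cycleWalk] at hep
  obtain ⟨hs, ht⟩ := Prod.mk.inj hep
  have hhead : w.head = 0 := hs
  replace ht : w.length % 2 = n % 2 := by rwa [tgt_of_consistent hc, hhead, zero_add] at ht
  have hlen : w.length = n := by
    rw [Nat.odd_iff] at hm
    rw [Nat.even_iff] at hn
    omega
  obtain ⟨v, l⟩ := w
  obtain rfl : v = 0 := hhead
  have hl := eq_cycleSteps hc.2
  rw [show l.length = n from hlen] at hl
  exact congrArg (Walk.mk 0) hl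

/-- No order-based semantics is ·-composable. -/
theorem no_orderBased_concatComposable
    (le : Walk → Walk → Prop) (hle : Suitable le) :
    ∃ (D : Database) (R R' : RE),
      ¬ (setConcat (OrderSem le D R) (OrderSem le D R') ⊆ OrderSem le D (R * R')) := by
  obtain ⟨i, j, hij, hl⟩ := hle.2 cycleDB (fun n => cycleWalk (2 + 2 * n))
    fun n => consistent_cycleWalk _
  refine ⟨cycleDB, lengthRE 1 2, lengthRE (2 * i + 1) (2 * j), fun hsub => ?_⟩
  have hmin := hsub ⟨_, cycleWalk_mem_orderSem le odd_one even_two, _,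
    cycleWalk_mem_orderSem le (odd_two_mul_add_one i) (even_two_mul j),
    congrArg Prod.snd (ep_cycleWalk 2), rfl⟩
  have hcat : (cycleWalk 2).concat (cycleWalk (2 * j)) = cycleWalk (2 + 2 * j) :=
    congrArg (Walk.mk 0) (cycleSteps_append zero_le_one 2 (2 * j) even_two)
  rw [hcat] at hmin
  have hmatch : cycleWalk (2 + 2 * i) ∈
      Matches cycleDB (lengthRE 1 2 * lengthRE (2 * i + 1) (2 * j)) := by
    refine ⟨consistent_cycleWalk _, ?_⟩
    rw [label_cycleDB, length_cycleWalk, RegularExpression.matches'_mul, Language.mem_mul]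
    refine ⟨_, replicate_mem_lengthRE.2 (.inl rfl), _, replicate_mem_lengthRE.2 (.inl rfl), ?_⟩
    rw [← List.replicate_add]
    congr 1
    omega
  have heq := hmin.2 _ hmatch (by simp [ep_cycleWalk]) hl
  have := congrArg Walk.length heq
  simp only [length_cycleWalk] at this
  omega

end RPQ
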